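/- Let k be a positive even integer. Let G be a finite simple graph on vertex set V, let u₁, …, uₙ be distinct vertices of V, and suppose every edge of G is incident to at least one uₜ. For 0 ≤ t ≤ n, let Gₜ be the subgraph of G consisting of all edges of G both of whose endpoints lie in V ∖ {u_{t+1}, …, uₙ} (so G₀ has no edges and Gₙ = G). Let M₀ = ∅, and for each 1 ≤ t ≤ n suppose the matching Mₜ in Gₜ satisfies: if there exists an augmenting path in Gₜ with respect to M_{t−1} that contains uₜ and has length at most k − 1, then Mₜ = M_{t−1}△Pₜ for some such path Pₜ of minimum length among augmenting paths with respect to M_{t−1} containing uₜ; otherwise Mₜ = M_{t−1}. Then for every 0 ≤ t ≤ n, every augmenting path in Gₜ with respect to Mₜ has length at least k + 1, and in particular |Mₙ| ≥ (1 − 2/(k + 2)) · ν(G), where ν(G) is the maximum cardinality of a matching in G. -/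

import Mathlib

open scoped Classical symmDiff

/-- `M` is a matching in the simple graph `G`: a set of edges of `G`
no two of which share an endpoint. -/
def IsMatching {V : Type*} (G : SimpleGraph V) (M : Finset (Sym2 V)) : Prop :=
  (M : Set (Sym2 V)) ⊆ G.edgeSet ∧
    ∀ e ∈ M, ∀ f ∈ M, e ≠ f → ∀ v : V, v ∈ e → v ∉ f

/-- A vertex is matched by `M` if it is an endpoint of some edge of `M`. -/
def Matched {V : Type*} (M : Finset (Sym2 V)) (v : V) : Prop :=
  ∃ e ∈ M, v ∈ e

/-- A list of edges alternates with respect to the matching `M`. -/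
def Alternating {V : Type*} (M : Finset (Sym2 V)) (l : List (Sym2 V)) : Prop :=
  ∀ (i : ℕ) (h : i + 1 < l.length), ((l[i]'(by omega)) ∈ M ↔ (l[i + 1]'h) ∉ M)

/-- `p` is an augmenting path in `G` with respect to the matching `M`:
a path with at least one edge, both of whose endpoints are exposed, and whose
edges alternate between edges not in `M` and edges in `M`. -/
structure IsAugPath {V : Type*} (G : SimpleGraph V) (M : Finset (Sym2 V))
    {a b : V} (p : G.Walk a b) : Prop where
  isPath : p.IsPath
  pos : 0 < p.length
  expA : ¬ Matched M a
  expB : ¬ Matched M b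
  alt : Alternating M p.edges

lemma card_filter_odd_range (L : ℕ) : ((Finset.range L).filter Odd).card = L / 2 := by
  induction L with
  | zero => simp
  | succ L ih =>
    rw [Finset.range_add_one, Finset.filter_insert]
    split_ifs with h
    · rw [Finset.card_insert_of_notMem (by simp), ih]
      obtain ⟨m, rfl⟩ := h
      omega
    · rw [ih]
      obtain ⟨m, rfl⟩ := Nat.not_odd_iff_even.1 h
      omega

section Edges

variable {V : Type*}

/-- The edge set of the sequence `x 0, …, x L` of vertices. -/
noncomputable def seqEdges [DecidableEq V] (x : ℕ → V) (L : ℕ) : Finset (Sym2 V) :=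
  (Finset.range L).image fun i => s(x i, x (i + 1))

variable [DecidableEq V] {x : ℕ → V} {L : ℕ}

lemma mem_seqEdges {e : Sym2 V} : e ∈ seqEdges x L ↔ ∃ i < L, s(x i, x (i + 1)) = e := by
  simp [seqEdges]

omit [DecidableEq V] in
lemma edge_injOn (hx : Set.InjOn x (Set.Iic L)) :
    Set.InjOn (fun i => s(x i, x (i + 1))) (Finset.range L : Set ℕ) := by
  intro i hi j hj h
  simp only [Finset.coe_range, Set.mem_Iio] at hi hj
  have inj : ∀ a b, a ≤ L → b ≤ L → x a = x b → a = b := fun a b ha hb h => hx ha hb h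
  rcases Sym2.eq_iff.1 h with ⟨h1, -⟩ | ⟨h1, h2⟩
  · exact inj _ _ (by omega) (by omega) h1
  · have := inj _ _ (by omega) (by omega) h1
    have := inj _ _ (by omega) (by omega) h2
    omega

lemma card_seqEdges (hx : Set.InjOn x (Set.Iic L)) : (seqEdges x L).card = L := by
  rw [seqEdges, Finset.card_image_of_injOn (edge_injOn hx), Finset.card_range]

lemma card_seqEdges_inter (hx : Set.InjOn x (Set.Iic L)) {M : Finset (Sym2 V)}
    (hM : ∀ i < L, (s(x i, x (i + 1)) ∈ M ↔ Odd i)) :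
    (seqEdges x L ∩ M).card = L / 2 := by
  have : seqEdges x L ∩ M =
      ((Finset.range L).filter Odd).image fun i => s(x i, x (i + 1)) := by
    ext e
    simp only [Finset.mem_inter, mem_seqEdges, Finset.mem_image, Finset.mem_filter,
      Finset.mem_range]
    constructor
    · rintro ⟨⟨i, hi, rfl⟩, h⟩
      exact ⟨i, ⟨hi, (hM i hi).1 h⟩, rfl⟩
    · rintro ⟨i, ⟨hi, ho⟩, rfl⟩
      exact ⟨⟨i, hi, rfl⟩, (hM i hi).2 ho⟩
  rw [this, Finset.card_image_of_injOn, card_filter_odd_range]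
  exact (edge_injOn hx).mono (by intro i hi; simp at hi ⊢; exact hi.1)

omit [DecidableEq V] in
lemma exists_walk_getVert {G : SimpleGraph V} (x : ℕ → V) (L : ℕ)
    (h : ∀ i < L, G.Adj (x i) (x (i + 1))) :
    ∃ p : G.Walk (x 0) (x L), p.length = L ∧ ∀ i ≤ L, p.getVert i = x i := by
  induction L generalizing x with
  | zero => exact ⟨.nil, rfl, by simp⟩
  | succ L ih =>
    obtain ⟨p, hp, hv⟩ := ih (fun i => x (i + 1)) fun i hi => h (i + 1) (by omega)
    refine ⟨.cons (h 0 (by omega)) p, by simp [hp], fun i hi => ?_⟩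
    cases i with
    | zero => simp
    | succ i => simpa using hv i (by omega)

lemma edges_toFinset_eq {G : SimpleGraph V} {a b : V} (p : G.Walk a b) :
    p.edges.toFinset = seqEdges p.getVert p.length := by
  ext e
  rw [List.mem_toFinset, mem_seqEdges, List.mem_iff_getElem]
  simp only [SimpleGraph.Walk.length_edges]
  constructor
  · rintro ⟨i, hi, rfl⟩
    exact ⟨i, hi, (p.getElem_edges (by simpa using hi)).symm⟩
  · rintro ⟨i, hi, rfl⟩
    exact ⟨i, hi, p.getElem_edges (by simpa using hi)⟩

end Edges

lemma IsMatching.mono {V : Type*} {G H : SimpleGraph V} {M : Finset (Sym2 V)}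
    (hM : IsMatching G M) (h : G ≤ H) : IsMatching H M :=
  ⟨hM.1.trans (SimpleGraph.edgeSet_mono h), hM.2⟩

lemma IsMatching.eq_of_mem {V : Type*} {G : SimpleGraph V} {M : Finset (Sym2 V)}
    (hM : IsMatching G M) {e f : Sym2 V} (he : e ∈ M) (hf : f ∈ M) {v : V}
    (hve : v ∈ e) (hvf : v ∈ f) : e = f := by
  by_contra h
  exact hM.2 e he f hf h v hve hvf

section AugPath

variable {V : Type*} [DecidableEq V] {G : SimpleGraph V} {M : Finset (Sym2 V)} {a b : V}
  {p : G.Walk a b}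

omit [DecidableEq V] in
lemma IsAugPath.edge_mem_iff (hp : IsAugPath G M p) {i : ℕ} (hi : i < p.length) :
    s(p.getVert i, p.getVert (i + 1)) ∈ M ↔ Odd i := by
  induction i with
  | zero =>
    simp only [Nat.not_odd_zero, iff_false]
    exact fun h => hp.expA ⟨_, h, by simp⟩
  | succ i ih =>
    have h := hp.alt i (by simpa using hi)
    rw [p.getElem_edges, p.getElem_edges] at h
    rw [Nat.odd_add_one, ← ih (by omega), h, not_not]

omit [DecidableEq V] in
lemma IsAugPath.odd_length (hp : IsAugPath G M p) : Odd p.length := by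
  have hpos := hp.pos
  by_contra h
  have h' : Odd (p.length - 1) := by
    obtain ⟨m, hm⟩ := Nat.not_odd_iff_even.1 h
    exact ⟨m - 1, by omega⟩
  have := (hp.edge_mem_iff (by omega)).2 h'
  refine hp.expB ⟨_, this, ?_⟩
  rw [show p.length - 1 + 1 = p.length by omega]
  simp

omit [DecidableEq V] in
lemma IsAugPath.injOn (hp : IsAugPath G M p) : Set.InjOn p.getVert (Set.Iic p.length) :=
  hp.isPath.getVert_injOn

lemma IsAugPath.card_edges (hp : IsAugPath G M p) : p.edges.toFinset.card = p.length := by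
  rw [edges_toFinset_eq, card_seqEdges hp.injOn]

lemma IsAugPath.card_edges_inter (hp : IsAugPath G M p) :
    (p.edges.toFinset ∩ M).card = p.length / 2 := by
  rw [edges_toFinset_eq, card_seqEdges_inter hp.injOn fun i hi => hp.edge_mem_iff hi]

lemma IsAugPath.card_symmDiff (hp : IsAugPath G M p) :
    (M ∆ p.edges.toFinset).card = M.card + 1 := by
  have h1 := hp.card_edges
  have h2 := hp.card_edges_inter
  obtain ⟨m, hm⟩ := hp.odd_length
  set T := p.edges.toFinset
  have h3 := Finset.card_sdiff_add_card_inter M T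
  have h4 := Finset.card_sdiff_add_card_inter T M
  have h5 : (M ∆ T).card = (M \ T).card + (T \ M).card :=
    Finset.card_union_of_disjoint disjoint_sdiff_sdiff
  rw [Finset.inter_comm] at h3
  omega

/-- Every inner edge of an augmenting path is followed and preceded by an edge of the
other kind, so the matching edge at a vertex of the path belongs to the path. -/
lemma IsAugPath.mem_edges_of_mem (hM : IsMatching G M) (hp : IsAugPath G M p)
    {e : Sym2 V} (he : e ∈ M) {j : ℕ} (hj : j ≤ p.length) (hv : p.getVert j ∈ e) :
    e ∈ p.edges.toFinset := by
  rw [edges_toFinset_eq, mem_seqEdges]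
  obtain ⟨m, hm⟩ := hp.odd_length
  rcases Nat.even_or_odd' j with ⟨c, rfl | rfl⟩
  · rcases Nat.eq_zero_or_pos c with rfl | hc
    · exact absurd ⟨e, he, by simpa using hv⟩ hp.expA
    · have := (hp.edge_mem_iff (i := 2 * c - 1) (by omega)).2 ⟨c - 1, by omega⟩
      refine ⟨2 * c - 1, by omega, hM.eq_of_mem this he ?_ hv⟩
      rw [show 2 * c - 1 + 1 = 2 * c by omega]
      simp
  · rcases hj.eq_or_lt with h | h
    · refine absurd ⟨e, he, ?_⟩ hp.expB
      rw [h] at hv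
      simpa using hv
    · have := (hp.edge_mem_iff h).2 ⟨c, rfl⟩
      exact ⟨2 * c + 1, h, hM.eq_of_mem this he (by simp) hv⟩

lemma IsAugPath.eq_of_not_mem (hp : IsAugPath G M p) {e f : Sym2 V}
    (he : e ∈ p.edges.toFinset) (hf : f ∈ p.edges.toFinset) (heM : e ∉ M) (hfM : f ∉ M)
    {v : V} (hve : v ∈ e) (hvf : v ∈ f) : e = f := by
  rw [edges_toFinset_eq, mem_seqEdges] at he hf
  obtain ⟨i, hi, rfl⟩ := he
  obtain ⟨j, hj, rfl⟩ := hf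
  rw [hp.edge_mem_iff hi, Nat.not_odd_iff_even] at heM
  rw [hp.edge_mem_iff hj, Nat.not_odd_iff_even] at hfM
  have inj : ∀ a b, a ≤ p.length → b ≤ p.length → p.getVert a = p.getVert b → a = b :=
    fun a b ha hb h => hp.injOn ha hb h
  obtain ⟨c, rfl⟩ := heM
  obtain ⟨d, rfl⟩ := hfM
  have : c = d := by
    rw [Sym2.mem_iff] at hve hvf
    rcases hve with rfl | rfl <;> rcases hvf with h | h <;>
      have := inj _ _ (by omega) (by omega) h <;> omega
  rw [this]

lemma IsAugPath.isMatching_symmDiff (hM : IsMatching G M) (hp : IsAugPath G M p) :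
    IsMatching G (M ∆ p.edges.toFinset) := by
  refine ⟨fun e he => ?_, fun e he f hf hne v hve hvf => hne ?_⟩
  · rcases Finset.mem_symmDiff.1 (Finset.mem_coe.1 he) with ⟨h, -⟩ | ⟨h, -⟩
    · exact hM.1 h
    · exact p.edges_subset_edgeSet (List.mem_toFinset.1 h)
  · have mixed : ∀ e f : Sym2 V, e ∈ M → e ∉ p.edges.toFinset → f ∈ p.edges.toFinset →
        v ∈ e → v ∈ f → False := by
      intro e f heM heT hfT hve hvf
      rw [edges_toFinset_eq, mem_seqEdges] at hfT
      obtain ⟨j, hj, rfl⟩ := hfT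
      rcases Sym2.mem_iff.1 hvf with rfl | rfl
      · exact heT (hp.mem_edges_of_mem hM heM hj.le hve)
      · exact heT (hp.mem_edges_of_mem hM heM hj hve)
    rcases Finset.mem_symmDiff.1 he with ⟨h1, h2⟩ | ⟨h1, h2⟩ <;>
      rcases Finset.mem_symmDiff.1 hf with ⟨h3, h4⟩ | ⟨h3, h4⟩
    · exact hM.eq_of_mem h1 h3 hve hvf
    · exact (mixed e f h1 h2 h3 hve hvf).elim
    · exact (mixed f e h3 h4 h1 hvf hve).elim
    · exact hp.eq_of_not_mem h1 h3 h2 h4 hve hvf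

omit [DecidableEq V] in
lemma IsAugPath.transfer {H : SimpleGraph V} (hp : IsAugPath G M p)
    (h : ∀ e ∈ p.edges, e ∈ H.edgeSet) : IsAugPath H M (p.transfer H h) where
  isPath := hp.isPath.transfer h
  pos := by simpa using hp.pos
  expA := hp.expA
  expB := hp.expB
  alt := by rw [SimpleGraph.Walk.edges_transfer]; exact hp.alt

lemma exists_isAugPath_of_seq {x : ℕ → V} {L : ℕ} (hx : Set.InjOn x (Set.Iic L))
    (hadj : ∀ i < L, s(x i, x (i + 1)) ∈ G.edgeSet)
    (hM : ∀ i < L, (s(x i, x (i + 1)) ∈ M ↔ Odd i)) (hL : 0 < L)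
    (h0 : ¬ Matched M (x 0)) (h1 : ¬ Matched M (x L)) :
    ∃ p : G.Walk (x 0) (x L), IsAugPath G M p ∧ p.edges.toFinset = seqEdges x L := by
  obtain ⟨p, hp, hv⟩ := exists_walk_getVert x L hadj
  refine ⟨p, ⟨?_, by omega, h0, h1, ?_⟩, ?_⟩
  · rw [← SimpleGraph.Walk.IsPath.getVert_injOn_iff]
    intro i hi j hj h
    simp only [Set.mem_ofPred_eq, hp] at hi hj
    rw [hv i hi, hv j hj] at h
    exact hx hi hj h
  · intro i hi
    have hi' : i + 1 < L := by simpa [hp] using hi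
    rw [p.getElem_edges, p.getElem_edges, hv _ (by omega), hv _ (by omega), hv _ (by omega),
      hM _ (by omega), hM _ hi', Nat.odd_add_one, not_not]
  · rw [edges_toFinset_eq, hp]
    ext e
    simp only [mem_seqEdges]
    refine exists_congr fun i => and_congr_right fun hi => ?_
    rw [hv i hi.le, hv (i + 1) hi]

end AugPath

section Components

variable {V : Type*} [DecidableEq V]

/-- `S` is a union of connected components of the edge set `D`. -/
def ClosedIn (S D : Finset (Sym2 V)) : Prop :=
  S ⊆ D ∧ ∀ e ∈ S, ∀ f ∈ D, ∀ v, v ∈ e → v ∈ f → f ∈ S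

omit [DecidableEq V] in
lemma ClosedIn.refl (D : Finset (Sym2 V)) : ClosedIn D D :=
  ⟨subset_rfl, fun _ _ _ hf _ _ _ => hf⟩

lemma ClosedIn.sdiff {S T D : Finset (Sym2 V)} (hS : ClosedIn S D) (hT : ClosedIn T D) :
    ClosedIn (S \ T) D := by
  refine ⟨Finset.sdiff_subset.trans hS.1, fun e he f hf v hve hvf => ?_⟩
  rw [Finset.mem_sdiff] at he ⊢
  exact ⟨hS.2 e he.1 f hf v hve hvf, fun h => he.2 (hT.2 f h e (hS.1 he.1) v hvf hve)⟩

lemma IsMatching.card_biUnion_toFinset {G : SimpleGraph V}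
    {M S : Finset (Sym2 V)} (hM : IsMatching G M) (hS : S ⊆ M) :
    (S.biUnion Sym2.toFinset).card = 2 * S.card := by
  rw [Finset.card_biUnion, Finset.sum_const_nat (m := 2), mul_comm]
  · intro e he
    exact Sym2.card_toFinset_of_not_isDiag e (G.not_isDiag_of_mem_edgeSet (hM.1 (hS he)))
  · intro e he f hf hne
    rw [Function.onFun, Finset.disjoint_left]
    intro v hve hvf
    rw [Sym2.mem_toFinset] at hve hvf
    exact hM.2 e (hS he) f (hS hf) hne v hve hvf

/-- The vertices `x 0, …, x L` form a path in `S` whose edges alternate between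
`N` and `M`, starting with `N`. -/
structure IsAltSeq (M N S : Finset (Sym2 V)) (x : ℕ → V) (L : ℕ) : Prop where
  inj : Set.InjOn x (Set.Iic L)
  mem : ∀ i < L, s(x i, x (i + 1)) ∈ S
  even : ∀ i < L, Even i → s(x i, x (i + 1)) ∈ N
  odd : ∀ i < L, Odd i → s(x i, x (i + 1)) ∈ M

variable {G : SimpleGraph V} {M N S : Finset (Sym2 V)} {x : ℕ → V} {L : ℕ}

omit [DecidableEq V] in
lemma IsAltSeq.exists_even (hx : IsAltSeq M N S x L) (hN : IsMatching G N) {e : Sym2 V}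
    (he : e ∈ N) {j : ℕ} (hj : j ≤ L) (hv : x j ∈ e) (hend : ¬ (j = L ∧ Even L)) :
    ∃ i < L, Even i ∧ s(x i, x (i + 1)) = e := by
  rcases Nat.even_or_odd j with h | h
  · have hjL : j < L := lt_of_le_of_ne hj fun h' => hend ⟨h', h' ▸ h⟩
    exact ⟨j, hjL, h, hN.eq_of_mem (hx.even j hjL h) he (by simp) hv⟩
  · obtain ⟨c, rfl⟩ := h
    exact ⟨2 * c, by omega, by simp, hN.eq_of_mem (hx.even _ (by omega) (by simp)) he
      (by simp) hv⟩

omit [DecidableEq V] in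
lemma IsAltSeq.exists_odd (hx : IsAltSeq M N S x L) (hM : IsMatching G M)
    (h0 : ¬ Matched M (x 0)) {e : Sym2 V}
    (he : e ∈ M) {j : ℕ} (hj : j ≤ L) (hv : x j ∈ e) (hend : ¬ (j = L ∧ Odd L)) :
    ∃ i < L, Odd i ∧ s(x i, x (i + 1)) = e := by
  rcases Nat.even_or_odd j with h | h
  · obtain ⟨c, rfl⟩ := h
    rcases c with _ | c
    · exact absurd ⟨e, he, hv⟩ h0
    · have ho : Odd (c + c + 1) := ⟨c, by omega⟩
      refine ⟨c + c + 1, by omega, ho, hM.eq_of_mem (hx.odd _ (by omega) ho) he ?_ hv⟩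
      rw [show c + 1 + (c + 1) = c + c + 1 + 1 by omega]
      simp
  · have hjL : j < L := lt_of_le_of_ne hj fun h' => hend ⟨h', h' ▸ h⟩
    exact ⟨j, hjL, h, hM.eq_of_mem (hx.odd j hjL h) he (by simp) hv⟩

omit [DecidableEq V] in
lemma IsAltSeq.extend (hx : IsAltSeq M N S x L) {c : V} (hc : ∀ j ≤ L, c ≠ x j)
    (hS : s(x L, c) ∈ S) (he : Even L → s(x L, c) ∈ N) (ho : Odd L → s(x L, c) ∈ M) :
    ∃ y, y 0 = x 0 ∧ IsAltSeq M N S y (L + 1) := by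
  have hy : ∀ i ≤ L, Function.update x (L + 1) c i = x i := fun i hi =>
    Function.update_of_ne (by omega) _ _
  have hl : Function.update x (L + 1) c (L + 1) = c := Function.update_self _ _ _
  refine ⟨Function.update x (L + 1) c, hy 0 (by omega), ?_, ?_, ?_, ?_⟩
  · intro i hi j hj h
    simp only [Set.mem_Iic] at hi hj
    rcases Nat.lt_or_ge L i with hi' | hi' <;> rcases Nat.lt_or_ge L j with hj' | hj'
    · omega
    · obtain rfl : i = L + 1 := by omega
      rw [hl, hy j hj'] at h
      exact absurd h (hc j hj')
    · obtain rfl : j = L + 1 := by omega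
      rw [hl, hy i hi'] at h
      exact absurd h.symm (hc i hi')
    · rw [hy i hi', hy j hj'] at h
      exact hx.inj hi' hj' h
  all_goals
    intro i hi
    rcases (Nat.lt_succ_iff.1 hi).eq_or_lt with rfl | hi'
    · rw [hl, hy i le_rfl]
      assumption
    · rw [hy i hi'.le, hy (i + 1) hi']
      first | exact hx.mem i hi' | exact hx.even i hi' | exact hx.odd i hi'

omit [DecidableEq V] in
lemma IsAltSeq.exists_maximal [Fintype V] (M N S : Finset (Sym2 V)) (v : V) :
    ∃ x L, x 0 = v ∧ IsAltSeq M N S x L ∧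
      ∀ y, y 0 = v → ¬ IsAltSeq M N S y (L + 1) := by
  let P : ℕ → Prop := fun L => ∃ x : ℕ → V, x 0 = v ∧ IsAltSeq M N S x L
  have h0 : P 0 := ⟨fun _ => v, rfl, fun i hi j hj _ => by simp at hi hj; omega,
    by simp, by simp, by simp⟩
  have hb : ∀ L, P L → L ≤ Fintype.card V := by
    rintro L ⟨x, -, hx⟩
    have := Finset.card_le_card_of_injOn (s := Finset.range L) (t := Finset.univ) x
      (by simp) (hx.inj.mono fun i hi => by simp at hi ⊢; omega)
    simpa using this
  obtain ⟨x, hx0, hx⟩ := Nat.findGreatest_spec (P := P) (Nat.zero_le (Fintype.card V)) h0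
  refine ⟨x, _, hx0, hx, fun y hy0 hy => ?_⟩
  have hP : P _ := ⟨y, hy0, hy⟩
  have := Nat.le_findGreatest (hb _ hP) hP
  omega

lemma ClosedIn.not_matched (hN : IsMatching G N)
    (hS : ClosedIn S (M ∆ N)) {v : V} {f : Sym2 V} (hfS : f ∈ S) (hfN : f ∈ N) (hv : v ∈ f)
    (h : ∀ e ∈ S, e ∈ M → v ∉ e) : ¬ Matched M v := by
  rintro ⟨e, he, hve⟩
  have hfM : f ∉ M := fun hfM => h f hfS hfM hv
  have heN : e ∉ N := fun heN => hfM (hN.eq_of_mem heN hfN hve hv ▸ he)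
  exact h e (hS.2 f hfS e (Finset.mem_symmDiff.2 (.inl ⟨he, heN⟩)) v hv hve) he hve

lemma card_sdiff_inter_add {S T : Finset (Sym2 V)} (h : T ⊆ S) (R : Finset (Sym2 V)) :
    ((S \ T) ∩ R).card + (T ∩ R).card = (S ∩ R).card := by
  rw [← Finset.card_union_of_disjoint
    (Finset.disjoint_of_subset_left Finset.inter_subset_left
      (Finset.disjoint_of_subset_right Finset.inter_subset_left Finset.sdiff_disjoint)),
    ← Finset.union_inter_distrib_right, Finset.sdiff_union_of_subset h]

/-- In a subset `T` of `M ∆ N` every edge is in exactly one of `M` and `N`. -/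
lemma card_inter_add_card_inter {T : Finset (Sym2 V)} (hT : T ⊆ M ∆ N) :
    (T ∩ M).card + (T ∩ N).card = T.card := by
  have h : T ∩ N = T \ M := by
    ext e
    simp only [Finset.mem_inter, Finset.mem_sdiff]
    have := fun h => Finset.mem_symmDiff.1 (hT h : e ∈ M ∆ N)
    tauto
  rw [h, Finset.card_inter_add_card_sdiff]

/-- The core of Berge's theorem, localised to a union `S` of components of `M ∆ N`. -/
lemma ClosedIn.exists_isAugPath [Fintype V] (hM : IsMatching G M) (hN : IsMatching G N)
    (hS : ClosedIn S (M ∆ N)) (hcard : (S ∩ M).card < (S ∩ N).card) :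
    ∃ (a b : V) (p : G.Walk a b), IsAugPath G M p ∧ p.edges.toFinset ⊆ S ∧
      ClosedIn p.edges.toFinset (M ∆ N) := by
  induction hn : S.card using Nat.strong_induction_on generalizing S with
  | _ n ih =>
  subst hn
  have hdisj : ∀ e ∈ S, e ∈ M ↔ e ∉ N := fun e he => by
    have := Finset.mem_symmDiff.1 (hS.1 he)
    tauto
  obtain ⟨v, hvN, hvM⟩ : ∃ v, v ∈ (S ∩ N).biUnion Sym2.toFinset ∧
      v ∉ (S ∩ M).biUnion Sym2.toFinset := by
    apply Finset.exists_mem_notMem_of_card_lt_card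
    rw [hM.card_biUnion_toFinset Finset.inter_subset_right,
      hN.card_biUnion_toFinset Finset.inter_subset_right]
    omega
  simp only [Finset.mem_biUnion, Finset.mem_inter, Sym2.mem_toFinset, not_exists, not_and]
    at hvN hvM
  obtain ⟨f, ⟨hfS, hfN⟩, hvf⟩ := hvN
  have hv : ¬ Matched M v := hS.not_matched hN hfS hfN hvf fun e h1 h2 => hvM e ⟨h1, h2⟩
  obtain ⟨x, L, rfl, hx, hmax⟩ := IsAltSeq.exists_maximal M N S v
  have inj : ∀ a b, a ≤ L → b ≤ L → x a = x b → a = b := fun a b ha hb h => hx.inj ha hb h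
  have hloop : ∀ e ∈ S, ¬ e.IsDiag := fun e he => by
    rcases Finset.mem_symmDiff.1 (hS.1 he) with h | h
    · exact G.not_isDiag_of_mem_edgeSet (hM.1 h.1)
    · exact G.not_isDiag_of_mem_edgeSet (hN.1 h.1)
  have hmaxN : ∀ e ∈ S, e ∈ N → Even L → x L ∉ e := by
    intro e heS heN hL hve
    obtain ⟨c, rfl⟩ := Sym2.mem_iff_exists.1 hve
    have hc : ∀ j ≤ L, c ≠ x j := by
      rintro j hj rfl
      have hjL : j ≠ L := by
        rintro rfl
        exact hloop _ heS (by simp)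
      obtain ⟨i, hi, hie, h⟩ := hx.exists_even hN heN hj (by simp) (by tauto)
      obtain ⟨m, rfl⟩ := hie
      obtain ⟨l, hl⟩ := hL
      rw [← h] at hve
      rcases Sym2.mem_iff.1 hve with h | h <;> have := inj _ _ (by omega) (by omega) h <;> omega
    obtain ⟨y, hy0, hy⟩ := hx.extend hc heS (fun _ => heN)
      fun h => absurd hL (Nat.not_even_iff_odd.2 h)
    exact hmax y hy0 hy
  have hmaxM : ∀ e ∈ S, e ∈ M → Odd L → x L ∉ e := by
    intro e heS heM hL hve
    obtain ⟨c, rfl⟩ := Sym2.mem_iff_exists.1 hve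
    have hc : ∀ j ≤ L, c ≠ x j := by
      rintro j hj rfl
      have hjL : j ≠ L := by
        rintro rfl
        exact hloop _ heS (by simp)
      obtain ⟨i, hi, hie, h⟩ := hx.exists_odd hM hv heM hj (by simp) (by tauto)
      obtain ⟨m, rfl⟩ := hie
      obtain ⟨l, hl⟩ := hL
      rw [← h] at hve
      rcases Sym2.mem_iff.1 hve with h | h <;> have := inj _ _ (by omega) (by omega) h <;> omega
    obtain ⟨y, hy0, hy⟩ := hx.extend hc heS
      (fun h => absurd h (Nat.not_even_iff_odd.2 hL)) fun _ => heM
    exact hmax y hy0 hy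
  have hsub : seqEdges x L ⊆ S := fun e he => by
    obtain ⟨i, hi, rfl⟩ := mem_seqEdges.1 he
    exact hx.mem i hi
  have hclosed : ClosedIn (seqEdges x L) (M ∆ N) := by
    refine ⟨hsub.trans hS.1, fun e he f hf v hve hvf => ?_⟩
    have hfS : f ∈ S := hS.2 e (hsub he) f hf v hve hvf
    obtain ⟨j, hj, rfl⟩ : ∃ j ≤ L, x j = v := by
      obtain ⟨i, hi, rfl⟩ := mem_seqEdges.1 he
      rcases Sym2.mem_iff.1 hve with h | h
      · exact ⟨i, hi.le, h.symm⟩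
      · exact ⟨i + 1, hi, h.symm⟩
    rw [mem_seqEdges]
    by_cases hfM : f ∈ M
    · obtain ⟨i, hi, -, h⟩ := hx.exists_odd hM hv hfM hj hvf fun h =>
        hmaxM f hfS hfM h.2 (h.1 ▸ hvf)
      exact ⟨i, hi, h⟩
    · have hfN : f ∈ N := by
        by_contra h
        exact hfM ((hdisj f hfS).2 h)
      obtain ⟨i, hi, -, h⟩ := hx.exists_even hN hfN hj hvf fun h =>
        hmaxN f hfS hfN h.2 (h.1 ▸ hvf)
      exact ⟨i, hi, h⟩
  have hiffM : ∀ i < L, (s(x i, x (i + 1)) ∈ M ↔ Odd i) := fun i hi =>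
    ⟨fun h => by
      by_contra ho
      exact (hdisj _ (hx.mem i hi)).1 h (hx.even i hi (Nat.not_odd_iff_even.1 ho)),
      hx.odd i hi⟩
  have hL0 : 0 < L := by
    rcases Nat.eq_zero_or_pos L with rfl | h
    · exact absurd hvf (hmaxN f hfS hfN (by simp))
    · exact h
  rcases Nat.even_or_odd' L with ⟨c, hc | hc⟩
  · have hcM := card_seqEdges_inter hx.inj hiffM
    have hcT := card_seqEdges hx.inj
    have hcN := card_inter_add_card_inter hclosed.1
    have hkM := card_sdiff_inter_add hsub M
    have hkN := card_sdiff_inter_add hsub N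
    have hlt : (S \ seqEdges x L).card < S.card := by
      rw [Finset.card_sdiff_of_subset hsub]
      have := Finset.card_le_card hsub
      omega
    obtain ⟨a, b, p, hp, hpS, hpc⟩ := ih _ hlt (hS.sdiff hclosed) (by omega) rfl
    exact ⟨a, b, p, hp, hpS.trans Finset.sdiff_subset, hpc⟩
  · have hLe := hx.even (L - 1) (by omega) ⟨c, by omega⟩
    have hLm := hx.mem (L - 1) (by omega)
    rw [show L - 1 + 1 = L by omega] at hLe hLm
    have hend : ¬ Matched M (x L) := hS.not_matched hN hLm hLe (by simp)
      fun e h1 h2 => hmaxM e h1 h2 ⟨c, hc⟩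
    obtain ⟨p, hp, hpe⟩ := exists_isAugPath_of_seq (G := G) hx.inj (fun i hi => by
      rcases Finset.mem_symmDiff.1 (hS.1 (hx.mem i hi)) with h | h
      · exact hM.1 h.1
      · exact hN.1 h.1) hiffM hL0 hv hend
    exact ⟨_, _, p, hp, hpe ▸ hsub, hpe ▸ hclosed⟩

lemma IsAugPath.card_edges_inter_right {a b : V} {p : G.Walk a b} (hp : IsAugPath G M p)
    (h : p.edges.toFinset ⊆ M ∆ N) :
    (p.edges.toFinset ∩ N).card = p.length / 2 + 1 := by
  have h1 := card_inter_add_card_inter h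
  rw [hp.card_edges, hp.card_edges_inter] at h1
  obtain ⟨m, hm⟩ := hp.odd_length
  omega

lemma symmDiff_inter_left (M N : Finset (Sym2 V)) : (M ∆ N) ∩ M = M \ N := by
  ext e
  simp only [Finset.mem_inter, Finset.mem_symmDiff, Finset.mem_sdiff]
  tauto

lemma symmDiff_inter_right (M N : Finset (Sym2 V)) : (M ∆ N) ∩ N = N \ M := by
  rw [symmDiff_comm, symmDiff_inter_left]

/-- If all augmenting paths have at least `h` matching edges, then `M` is within a factor
`h / (h + 1)` of any other matching, on every union of components of `M ∆ N`. -/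
lemma ClosedIn.mul_card_le [Fintype V] (hM : IsMatching G M) (hN : IsMatching G N) {h : ℕ}
    (hlong : ∀ (a b : V) (p : G.Walk a b), IsAugPath G M p → 2 * h + 1 ≤ p.length)
    (hS : ClosedIn S (M ∆ N)) : h * (S ∩ N).card ≤ (h + 1) * (S ∩ M).card := by
  induction hn : S.card using Nat.strong_induction_on generalizing S with
  | _ n ih =>
  subst hn
  rcases Nat.lt_or_ge (S ∩ M).card (S ∩ N).card with hlt | hge
  · obtain ⟨a, b, p, hp, hpS, hpc⟩ := hS.exists_isAugPath hM hN hlt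
    have hcM := card_sdiff_inter_add hpS M
    have hcN := card_sdiff_inter_add hpS N
    have hpos := hp.pos
    have hlen := hlong a b p hp
    rw [hp.card_edges_inter] at hcM
    rw [hp.card_edges_inter_right hpc.1] at hcN
    have hle := Finset.card_le_card hpS
    have hlt : (S \ p.edges.toFinset).card < S.card := by
      rw [Finset.card_sdiff_of_subset hpS]
      rw [hp.card_edges] at hle ⊢
      omega
    have := ih _ hlt (hS.sdiff hpc) rfl
    rw [← hcM, ← hcN]
    have : h ≤ p.length / 2 := by omega
    nlinarith
  · nlinarith

lemma IsMatching.mul_card_le [Fintype V] (hM : IsMatching G M) (hN : IsMatching G N) {h : ℕ}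
    (hlong : ∀ (a b : V) (p : G.Walk a b), IsAugPath G M p → 2 * h + 1 ≤ p.length) :
    h * N.card ≤ (h + 1) * M.card := by
  have key := (ClosedIn.refl (M ∆ N)).mul_card_le hM hN hlong
  rw [symmDiff_inter_right, symmDiff_inter_left] at key
  have h3 := Finset.card_sdiff_add_card_inter M N
  have h4 := Finset.card_sdiff_add_card_inter N M
  rw [Finset.inter_comm] at h4
  rw [← h3, ← h4]
  nlinarith

/-- Two matchings differing in size by two yield two edge-disjoint augmenting paths. -/
lemma IsMatching.exists_two_isAugPath [Fintype V] (hM : IsMatching G M) (hN : IsMatching G N)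
    (hcard : N.card = M.card + 2) :
    ∃ (a b c d : V) (p : G.Walk a b) (q : G.Walk c d), IsAugPath G M p ∧ IsAugPath G M q ∧
      p.edges.toFinset ⊆ M ∆ N ∧ q.edges.toFinset ⊆ M ∆ N \ p.edges.toFinset := by
  have h3 := Finset.card_sdiff_add_card_inter M N
  have h4 := Finset.card_sdiff_add_card_inter N M
  rw [Finset.inter_comm] at h4
  rw [← symmDiff_inter_right] at h4
  rw [← symmDiff_inter_left] at h3
  obtain ⟨a, b, p, hp, hpS, hpc⟩ :=
    (ClosedIn.refl (M ∆ N)).exists_isAugPath hM hN (by omega)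
  have hcM := card_sdiff_inter_add hpS M
  have hcN := card_sdiff_inter_add hpS N
  rw [hp.card_edges_inter] at hcM
  rw [hp.card_edges_inter_right hpc.1] at hcN
  obtain ⟨c, d, q, hq, hqS, -⟩ :=
    ((ClosedIn.refl (M ∆ N)).sdiff hpc).exists_isAugPath hM hN (by omega)
  exact ⟨a, b, c, d, p, q, hp, hq, hpS, hqS⟩

lemma IsAugPath.exists_mem_edges {a b : V} {p : G.Walk a b} (hp : IsAugPath G M p) {v : V}
    (hv : v ∈ p.support) : ∃ e ∈ p.edges.toFinset, v ∈ e := by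
  have hpos := hp.pos
  obtain ⟨j, rfl, hj⟩ := SimpleGraph.Walk.mem_support_iff_exists_getVert.1 hv
  rw [edges_toFinset_eq]
  rcases hj.eq_or_lt with h | h
  · refine ⟨_, mem_seqEdges.2 ⟨p.length - 1, by omega, rfl⟩, ?_⟩
    rw [show p.length - 1 + 1 = j by omega]
    simp
  · exact ⟨_, mem_seqEdges.2 ⟨j, h, rfl⟩, by simp⟩

/-- Let `v` be exposed, let `p` be an augmenting path of length at most `l`, and suppose that
augmenting paths have length at least that of `p`, and at least `l` if they avoid `v`.
Then all augmenting paths after augmenting along `p` have length at least `l`. -/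
lemma IsAugPath.le_length_of_symmDiff [Fintype V] (hM : IsMatching G M) {v : V}
    (hv : ¬ Matched M v) {l : ℕ} {a b : V} {p : G.Walk a b} (hp : IsAugPath G M p)
    (hpl : p.length ≤ l)
    (hmin : ∀ (x y : V) (q : G.Walk x y), IsAugPath G M q → v ∈ q.support →
      p.length ≤ q.length)
    (hlong : ∀ (x y : V) (q : G.Walk x y), IsAugPath G M q → v ∉ q.support → l ≤ q.length)
    {c d : V} {q : G.Walk c d} (hq : IsAugPath G (M ∆ p.edges.toFinset) q) :
    l ≤ q.length := by
  have hM1 := hp.isMatching_symmDiff hM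
  have hN := hq.isMatching_symmDiff hM1
  set N := M ∆ p.edges.toFinset ∆ q.edges.toFinset with hNdef
  have hcard : N.card = M.card + 2 := by rw [hNdef, hq.card_symmDiff, hp.card_symmDiff]
  have hD : M ∆ N = p.edges.toFinset ∆ q.edges.toFinset := by
    rw [hNdef, symmDiff_assoc, symmDiff_symmDiff_cancel_left]
  obtain ⟨x, y, z, w, r, s, hr, hs, hrD, hsD⟩ := hM.exists_two_isAugPath hN hcard
  have hsum : r.length + s.length ≤ p.length + q.length := by
    rw [← hr.card_edges, ← hs.card_edges, ← hp.card_edges, ← hq.card_edges]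
    have h1 := Finset.card_le_card hsD
    rw [Finset.card_sdiff_of_subset hrD] at h1
    have h2 := Finset.card_le_card hrD
    have h3 : (M ∆ N).card ≤ p.edges.toFinset.card + q.edges.toFinset.card := by
      rw [hD]
      exact (Finset.card_le_card Finset.symmDiff_subset_union).trans (Finset.card_union_le _ _)
    omega
  have hnot : ¬ (v ∈ r.support ∧ v ∈ s.support) := by
    rintro ⟨hvr, hvs⟩
    obtain ⟨e, he, hve⟩ := hr.exists_mem_edges hvr
    obtain ⟨f, hf, hvf⟩ := hs.exists_mem_edges hvs
    have mem : ∀ e ∈ M ∆ N, v ∈ e → e ∈ N := fun e he hve => by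
      rcases Finset.mem_symmDiff.1 he with h | h
      · exact absurd ⟨e, h.1, hve⟩ hv
      · exact h.1
    have hf' := Finset.mem_sdiff.1 (hsD hf)
    have := hN.eq_of_mem (mem e (hrD he) hve) (mem f hf'.1 hvf) hve hvf
    exact hf'.2 (this ▸ he)
  by_cases hvr : v ∈ r.support
  · have := hlong _ _ s hs fun h => hnot ⟨hvr, h⟩
    have := hmin _ _ r hr hvr
    omega
  · have := hlong _ _ r hr hvr
    by_cases hvs : v ∈ s.support
    · have := hmin _ _ s hs hvs
      omega
    · have := hlong _ _ s hs hvs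
      omega

end Components

/-- Online matching under vertex arrivals with a hard reassignment budget `k`:
the distinct vertices `u 0, …, u (n-1)` arrive one by one (every edge of `G` is
incident to some `u t`), `Gt t` is the subgraph of `G` induced by the edges both
of whose endpoints have already arrived by time `t`, and the algorithm augments
along a shortest augmenting path containing the newly arrived vertex whenever one
of length at most `k - 1` exists.  Then after every timestep `t` every augmenting
path in `Gt t` with respect to the current matching `M t` has length at least
`k + 1`; in particular the final matching `M n` satisfies
`|M n| ≥ (1 - 2/(k+2)) · ν(G)`. -/
theorem stmt9 {V : Type*} [Fintype V] [DecidableEq V]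
    (k : ℕ) (hk0 : 0 < k) (hk2 : Even k)
    (G : SimpleGraph V) (n : ℕ) (u : Fin n → V) (hinj : Function.Injective u)
    (hcover : ∀ e ∈ G.edgeSet, ∃ t : Fin n, u t ∈ e)
    (Gt : ℕ → SimpleGraph V)
    (hGt : ∀ (t : ℕ) (x y : V), (Gt t).Adj x y ↔
      (G.Adj x y ∧ ∀ s : Fin n, t ≤ (s : ℕ) → x ≠ u s ∧ y ≠ u s))
    (M : ℕ → Finset (Sym2 V)) (hM0 : M 0 = ∅)
    (hmatch : ∀ t ≤ n, IsMatching (Gt t) (M t))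
    (hstep : ∀ t : Fin n,
      (∃ (a b : V) (p : (Gt ((t : ℕ) + 1)).Walk a b),
          IsAugPath (Gt ((t : ℕ) + 1)) (M t) p ∧ u t ∈ p.support ∧
          p.length ≤ k - 1 ∧
          (∀ (x y : V) (q : (Gt ((t : ℕ) + 1)).Walk x y),
            IsAugPath (Gt ((t : ℕ) + 1)) (M t) q → u t ∈ q.support →
              p.length ≤ q.length) ∧
          M ((t : ℕ) + 1) = M t ∆ p.edges.toFinset) ∨
      ((¬ ∃ (a b : V) (p : (Gt ((t : ℕ) + 1)).Walk a b),
          IsAugPath (Gt ((t : ℕ) + 1)) (M t) p ∧ u t ∈ p.support ∧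
          p.length ≤ k - 1) ∧
        M ((t : ℕ) + 1) = M t)) :
    (∀ t ≤ n, ∀ (a b : V) (p : (Gt t).Walk a b), IsAugPath (Gt t) (M t) p →
      k + 1 ≤ p.length) ∧
    (∀ N : Finset (Sym2 V), IsMatching G N →
      (1 - 2 / ((k : ℝ) + 2)) * (N.card : ℝ) ≤ ((M n).card : ℝ)) := by
  have hGn : G ≤ Gt n := fun x y h => (hGt n x y).2 ⟨h, fun s hs => absurd s.2 (by omega)⟩
  have hodd : ∀ {L : ℕ}, Odd L → ¬ L ≤ k - 1 → k + 1 ≤ L := by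
    rintro L ⟨m, rfl⟩ h
    obtain ⟨c, rfl⟩ := hk2
    omega
  have hmain : ∀ t ≤ n, ∀ (a b : V) (p : (Gt t).Walk a b), IsAugPath (Gt t) (M t) p →
      k + 1 ≤ p.length := by
    intro t
    induction t with
    | zero =>
      intro _ a b p hp
      cases p with
      | nil => exact absurd hp.pos (by simp)
      | cons h _ =>
        obtain ⟨hG, hu⟩ := (hGt 0 _ _).1 h
        obtain ⟨s, hs⟩ := hcover s(_, _) hG
        obtain ⟨h1, h2⟩ := hu s (Nat.zero_le _)
        rcases Sym2.mem_iff.1 hs with h | h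
        · exact absurd h.symm h1
        · exact absurd h.symm h2
    | succ t ih =>
      intro ht a b q hq
      have hle : Gt t ≤ Gt (t + 1) := fun x y h => by
        obtain ⟨hG, hu⟩ := (hGt t x y).1 h
        exact (hGt (t + 1) x y).2 ⟨hG, fun s hs => hu s (by omega)⟩
      have hM := (hmatch t (by omega)).mono hle
      have hexp : ¬ Matched (M t) (u ⟨t, ht⟩) := by
        rintro ⟨e, he, hv⟩
        have heG := (hmatch t (by omega)).1 he
        obtain ⟨c, rfl⟩ := Sym2.mem_iff_exists.1 hv
        exact (((hGt t _ _).1 heG).2 ⟨t, ht⟩ le_rfl).1 rfl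
      have hlong : ∀ (x y : V) (q : (Gt (t + 1)).Walk x y), IsAugPath (Gt (t + 1)) (M t) q →
          u ⟨t, ht⟩ ∉ q.support → k + 1 ≤ q.length := by
        intro x y q hq hv
        have hE : ∀ e ∈ q.edges, e ∈ (Gt t).edgeSet := by
          intro e he
          induction e with
          | _ c d =>
          obtain ⟨hG, hu⟩ := (hGt (t + 1) c d).1 (q.edges_subset_edgeSet he)
          refine (hGt t c d).2 ⟨hG, fun s hs => ?_⟩
          rcases hs.eq_or_lt with h | h
          · obtain rfl : s = ⟨t, ht⟩ := Fin.ext h.symm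
            exact ⟨fun h => hv (h ▸ q.fst_mem_support_of_mem_edges he),
              fun h => hv (h ▸ q.snd_mem_support_of_mem_edges he)⟩
          · exact hu s h
        simpa using ih (by omega) _ _ _ (hq.transfer hE)
      rcases hstep ⟨t, ht⟩ with ⟨c, d, p, hp, -, hpk, hmin, hMt⟩ | ⟨hno, hMt⟩
      · simp only at hMt
        rw [hMt] at hq
        exact hp.le_length_of_symmDiff hM hexp (by omega) hmin hlong hq
      · simp only at hMt
        rw [hMt] at hq
        by_cases hv : u ⟨t, ht⟩ ∈ q.support
        · exact hodd hq.odd_length fun h => hno ⟨a, b, q, hq, hv, h⟩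
        · exact hlong a b q hq hv
  refine ⟨hmain, fun N hN => ?_⟩
  obtain ⟨h, rfl⟩ := hk2
  have key := (hmatch n le_rfl).mul_card_le (hN.mono hGn) (h := h) fun a b p hp => by
    have := hmain n le_rfl a b p hp
    omega
  have key' : (h : ℝ) * N.card ≤ (h + 1) * (M n).card := by exact_mod_cast key
  have hpos : (0 : ℝ) < h + 1 := by positivity
  have hfac : 1 - 2 / (((h + h : ℕ) : ℝ) + 2) = h / (h + 1) := by
    push_cast
    rw [show (h : ℝ) + h + 2 = 2 * (h + 1) by ring]
    field_simp
    ring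
  rw [hfac, div_mul_eq_mul_div, div_le_iff₀ hpos]
  linarith
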